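/- (Decomposition of pairings into an inchworm proper part and unlinked parts.) Let Sarr ∈ ℝ, let m̃ ≥ 2 be even, let p̃ ∈ {0,…,m̃−1}, and let s̃_{m̃} > ⋯ > s̃_1 be real numbers such that s̃_k > Sarr for k > p̃ and s̃_k < Sarr for k ≤ p̃. Let P be the set of tuples (p, n_p,…,n_1, q, q_p,…,q_0) such that: 0 ≤ p ≤ p̃ with p̃ − p even; n_1,…,n_p are even nonnegative integers with n_1+⋯+n_p ≤ p̃−p, and n_0 := p̃−p−(n_1+⋯+n_p); writing m := m̃ + p − p̃ and decomposing the decreasing sequence (s̃_{m̃},…,s̃_1) as the concatenation (s_m,…,s_{p+1}, s^{(p)}, s_p, s^{(p−1)}, s_{p−1}, …, s^{(1)}, s_1, s^{(0)}) where each block s^{(k)} has length n_k; q ∈ Q_Sarr(s_m,…,s_1); and q_k ∈ Q(s^{(k)}) for k = 0,…,p. Then the map (p, n_p,…,n_1, q, q_p,…,q_0) ↦ q ∪ q_p ∪ ⋯ ∪ q_0 is a bijection from P onto Q(s̃_{m̃},…,s̃_1). -/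

import Mathlib

open MeasureTheory Finset
open scoped BigOperators Classical

noncomputable section

namespace Inchworm

/-- Iterated simplex (Bochner) integral
`∫_{b > s_m > ⋯ > s_1 > a} φ(s_1,…,s_m) ds_1 ⋯ ds_m`,
interpreted as the iterated integral `∫_a^b ds_m ∫_a^{s_m} ds_{m-1} ⋯ ∫_a^{s_2} ds_1`.
The argument `s : Fin m → ℝ` lists the time points in increasing order:
`s ⟨i,_⟩ = s_{i+1}`. -/
def iterInt {X : Type*} [NormedAddCommGroup X] [NormedSpace ℝ X] :
    (m : ℕ) → ℝ → ℝ → ((Fin m → ℝ) → X) → X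
  | 0, _, _, φ => φ (fun i => i.elim0)
  | m + 1, a, b, φ => ∫ s in a..b, iterInt m a s (fun v => φ (Fin.snoc v s))

/-- Combine the lower `p` variables and the upper `m - p` variables into
a single vector of `m` variables. -/
def splice {m p : ℕ} (lower : Fin p → ℝ) (upper : Fin (m - p) → ℝ) : Fin m → ℝ :=
  fun i =>
    if h : (i : ℕ) < p then lower ⟨i, h⟩
    else upper ⟨(i : ℕ) - p, by have := i.isLt; omega⟩

/-- `q` is a pairing of the `m` (indices of) time points: every pair is ordered and
every index belongs to exactly one pair.  (In particular `m` must be even.) -/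
def IndexPairing {m : ℕ} (q : Finset (Fin m × Fin m)) : Prop :=
  (∀ p ∈ q, p.1 < p.2) ∧
    ∀ i : Fin m, ∃! p : Fin m × Fin m, p ∈ q ∧ (p.1 = i ∨ p.2 = i)

/-- The set `Q(s_m,…,s_1)` of all pairings, encoded on indices. -/
def pairings (m : ℕ) : Finset (Finset (Fin m × Fin m)) :=
  Finset.univ.filter IndexPairing

/-- Realize an index pairing as a set of pairs of real time points. -/
def realize {m : ℕ} (s : Fin m → ℝ) (q : Finset (Fin m × Fin m)) : Finset (ℝ × ℝ) :=
  q.image fun p => (s p.1, s p.2)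

/-- `L(Q) = ∏_{(τ₁,τ₂) ∈ Q} B(τ₁,τ₂)`, for a set `Q` of pairs of reals. -/
def Lreal (B : ℝ → ℝ → ℂ) (Q : Finset (ℝ × ℝ)) : ℂ := ∏ a ∈ Q, B a.1 a.2

/-- `L(q)` for an index pairing `q` realized through the time points `s`. -/
def Lfun (B : ℝ → ℝ → ℂ) {m : ℕ} (s : Fin m → ℝ) (q : Finset (Fin m × Fin m)) : ℂ :=
  Lreal B (realize s q)

/-- Two (ordered) pairs of reals are linked. -/
def LinkedPair (a b : ℝ × ℝ) : Prop :=
  (a.1 ≤ b.1 ∧ b.1 ≤ a.2 ∧ a.2 ≤ b.2) ∨ (b.1 ≤ a.1 ∧ a.1 ≤ b.2 ∧ b.2 ≤ a.2)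

/-- Two sets of pairs are linked. -/
def LinkedSets (Q₁ Q₂ : Finset (ℝ × ℝ)) : Prop := ∃ a ∈ Q₁, ∃ b ∈ Q₂, LinkedPair a b

/-- A set of pairs is linked if it cannot be decomposed into the union of two
nonempty sets of pairs that are not linked to each other. -/
def IsLinked (Q : Finset (ℝ × ℝ)) : Prop :=
  ¬ ∃ Q₁ Q₂ : Finset (ℝ × ℝ),
      Q₁.Nonempty ∧ Q₂.Nonempty ∧ Q = Q₁ ∪ Q₂ ∧ ¬ LinkedSets Q₁ Q₂

/-- The linked component of the pair `a` inside the set of pairs `Q`. -/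
def component (Q : Finset (ℝ × ℝ)) (a : ℝ × ℝ) : Finset (ℝ × ℝ) :=
  Q.filter fun b => Relation.ReflTransGen (fun x y => x ∈ Q ∧ y ∈ Q ∧ LinkedPair x y) a b

/-- A set of pairs is inchworm proper w.r.t. `Sarr` if every linked component
contains at least one time point `≥ Sarr`. -/
def InchwormProper (Sarr : ℝ) (Q : Finset (ℝ × ℝ)) : Prop :=
  ∀ a ∈ Q, ∃ b ∈ component Q a, Sarr ≤ b.1 ∨ Sarr ≤ b.2

/-- The set `Q_Sarr(s_m,…,s_1)` of inchworm proper pairings. -/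
def inchwormPairings (m : ℕ) (Sarr : ℝ) (s : Fin m → ℝ) :
    Finset (Finset (Fin m × Fin m)) :=
  (pairings m).filter fun q => InchwormProper Sarr (realize s q)

/-- The set `Q_c(s_m,…,s_1)` of linked pairings. -/
def linkedPairings (m : ℕ) (s : Fin m → ℝ) : Finset (Finset (Fin m × Fin m)) :=
  (pairings m).filter fun q => IsLinked (realize s q)

/-- `#{s < t}`: the number of time points below `t`. -/
def numLt (t : ℝ) {m : ℕ} (s : Fin m → ℝ) : ℕ :=
  (Finset.univ.filter fun i => s i < t).card

end Inchworm
namespace Inchworm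

/-- Extend a finite real sequence by zero. -/
def padR {m : ℕ} (s : Fin m → ℝ) : ℕ → ℝ := fun i => if h : i < m then s ⟨i, h⟩ else 0

/-- Extend a finite sequence of naturals by zero. -/
def padN {p : ℕ} (n : Fin p → ℕ) : ℕ → ℕ := fun i => if h : i < p then n ⟨i, h⟩ else 0

/-- Given the combined increasing sequence `s' = (s'_1,…,s'_{m'})` (0-based:
`s' ⟨i,_⟩ = s'_{i+1}`), decomposed as the concatenation (in increasing order)
`(s^{(0)}, s_1, s^{(1)}, s_2, …, s_p, s^{(p)}, s_{p+1}, …, s_m)` where block `s^{(k)}`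
has length `n k` and the points `s_{p+1},…,s_m` are the top `m' - p'` points of `s'`,
this is the main subsequence `(s_1,…,s_m)` (again 0-based). -/
def mainSeq {m' : ℕ} (s' : Fin m' → ℝ) (p' p : ℕ) (n : Fin (p + 1) → ℕ) (m : ℕ) :
    Fin m → ℝ :=
  fun i =>
    if (i : ℕ) < p then padR s' ((i : ℕ) + ∑ j ∈ Finset.range ((i : ℕ) + 1), padN n j)
    else padR s' (p' + ((i : ℕ) - p))

/-- The block subsequence `s^{(k)}` (of length `n k`) in the decomposition above. -/
def blockSeq {m' : ℕ} (s' : Fin m' → ℝ) (p : ℕ) (n : Fin (p + 1) → ℕ) (k : Fin (p + 1)) :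
    Fin (n k) → ℝ :=
  fun r => padR s' ((k : ℕ) + (∑ j ∈ Finset.range (k : ℕ), padN n j) + (r : ℕ))

end Inchworm
namespace Inchworm

/-- Data for the decomposition of a pairing of `m'` points (with `p'` of them below
`Sarr`): a split position `p`, block lengths `n : Fin (p+1) → ℕ`, an (index) pairing
`q` of the `m' + p - p'` main points, and (index) pairings `qs k` of the blocks. -/
def DecompTuple (m' p' : ℕ) : Type :=
  Σ p : ℕ, Σ n : Fin (p + 1) → ℕ,
    Finset (Fin (m' + p - p') × Fin (m' + p - p')) ×
      ((k : Fin (p + 1)) → Finset (Fin (n k) × Fin (n k)))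

/-- The admissible decomposition data `𝒫`: `p ≤ p'` with `p' - p` even, all block
lengths even with total length `p' - p`, `q` an inchworm proper pairing of the main
points, and each `qs k` a pairing of block `k`. -/
def decompSet (Sarr : ℝ) {m' : ℕ} (p' : ℕ) (s' : Fin m' → ℝ) :
    Set (DecompTuple m' p') :=
  {d | d.1 ≤ p' ∧ Even (p' - d.1) ∧ (∀ k, Even (d.2.1 k)) ∧
       (∑ k, d.2.1 k) = p' - d.1 ∧
       d.2.2.1 ∈ inchwormPairings (m' + d.1 - p') Sarr
         (mainSeq s' p' d.1 d.2.1 (m' + d.1 - p')) ∧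
       ∀ k, d.2.2.2 k ∈ pairings (d.2.1 k)}

/-- The map `(p, n, q, q_p, …, q_0) ↦ q ∪ q_p ∪ ⋯ ∪ q_0` (as sets of pairs of real
time points). -/
def decompMap {m' : ℕ} (p' : ℕ) (s' : Fin m' → ℝ) (d : DecompTuple m' p') :
    Finset (ℝ × ℝ) :=
  realize (mainSeq s' p' d.1 d.2.1 (m' + d.1 - p')) d.2.2.1 ∪
    Finset.univ.biUnion fun k => realize (blockSeq s' d.1 d.2.1 k) (d.2.2.2 k)

/-- `Q` is a perfect matching of the set `S` of time points by ordered pairs. -/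
def Matches (S : Set ℝ) (Q : Finset (ℝ × ℝ)) : Prop :=
  (∀ a ∈ Q, a.1 < a.2 ∧ a.1 ∈ S ∧ a.2 ∈ S) ∧
    ∀ x ∈ S, ∃! a : ℝ × ℝ, a ∈ Q ∧ (a.1 = x ∨ a.2 = x)

/-- The union of the linked components of `Q` reaching a time point `≥ Sarr`. -/
def properPart (Sarr : ℝ) (Q : Finset (ℝ × ℝ)) : Finset (ℝ × ℝ) :=
  Q.filter fun a => ∃ b ∈ component Q a, Sarr ≤ b.1 ∨ Sarr ≤ b.2

/-- The position of the first point of block `k` in the combined sequence. -/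
def blockStart {p : ℕ} (n : Fin (p + 1) → ℕ) (k : ℕ) : ℕ :=
  k + ∑ j ∈ Finset.range k, padN n j

/-- The position of the `i`-th main point in the combined sequence. -/
def mainPos (p' : ℕ) {p : ℕ} (n : Fin (p + 1) → ℕ) (i : ℕ) : ℕ :=
  if i < p then i + ∑ j ∈ Finset.range (i + 1), padN n j else p' + (i - p)

section Matchings

lemma realize_injective {m : ℕ} {t : Fin m → ℝ} (ht : Function.Injective t) :
    Function.Injective (realize t) :=
  Finset.image_injective (ht.prodMap ht)

lemma matches_realize {m : ℕ} {t : Fin m → ℝ} (ht : StrictMono t)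
    {q : Finset (Fin m × Fin m)} (hq : q ∈ pairings m) :
    Matches (Set.range t) (realize t q) := by
  obtain ⟨h1, h2⟩ := (Finset.mem_filter.1 hq).2
  constructor
  · intro a ha
    obtain ⟨b, hb, rfl⟩ := Finset.mem_image.1 ha
    exact ⟨ht (h1 b hb), ⟨_, rfl⟩, ⟨_, rfl⟩⟩
  · rintro _ ⟨i, rfl⟩
    obtain ⟨b, ⟨hb, hbi⟩, hu⟩ := h2 i
    refine ⟨(t b.1, t b.2), ⟨Finset.mem_image_of_mem _ hb, hbi.imp (congrArg t) (congrArg t)⟩, ?_⟩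
    rintro a ⟨ha, hai⟩
    obtain ⟨c, hc, rfl⟩ := Finset.mem_image.1 ha
    rw [hu c ⟨hc, hai.imp (fun h => ht.injective h) (fun h => ht.injective h)⟩]

lemma exists_realize_of_matches {m : ℕ} {t : Fin m → ℝ} (ht : StrictMono t)
    {Q : Finset (ℝ × ℝ)} (hQ : Matches (Set.range t) Q) :
    ∃ q ∈ pairings m, realize t q = Q := by
  have hr : realize t (Finset.univ.filter fun b => (t b.1, t b.2) ∈ Q) = Q := by
    ext a
    simp only [realize, Finset.mem_image, Finset.mem_filter, Finset.mem_univ, true_and]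
    constructor
    · rintro ⟨b, hb, rfl⟩
      exact hb
    · intro ha
      obtain ⟨-, ⟨i, hi⟩, j, hj⟩ := hQ.1 a ha
      have : (t i, t j) = a := by rw [hi, hj]
      exact ⟨(i, j), this ▸ ha, this⟩
  refine ⟨_, ?_, hr⟩
  refine Finset.mem_filter.2 ⟨Finset.mem_univ _, ?_, ?_⟩
  · intro b hb
    exact ht.lt_iff_lt.1 (hQ.1 _ (Finset.mem_filter.1 hb).2).1
  · intro i
    obtain ⟨a, ⟨ha, hai⟩, hu⟩ := hQ.2 (t i) ⟨i, rfl⟩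
    obtain ⟨-, ⟨j, hj⟩, k, hk⟩ := hQ.1 a ha
    have hjk : (t j, t k) = a := by rw [hj, hk]
    subst hjk
    refine ⟨(j, k), ⟨Finset.mem_filter.2 ⟨Finset.mem_univ _, ha⟩,
      hai.imp (fun h => ht.injective h) (fun h => ht.injective h)⟩, ?_⟩
    rintro b ⟨hb, hbi⟩
    have := hu (t b.1, t b.2) ⟨(Finset.mem_filter.1 hb).2,
      hbi.imp (congrArg t) (congrArg t)⟩
    simp only [Prod.mk.injEq] at this
    exact Prod.ext (ht.injective this.1) (ht.injective this.2)

lemma even_of_mem_pairings {m : ℕ} {q : Finset (Fin m × Fin m)} (hq : q ∈ pairings m) :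
    Even m := by
  obtain ⟨h1, h2⟩ := (Finset.mem_filter.1 hq).2
  have hU : (Finset.univ : Finset (Fin m)) = q.biUnion fun b => {b.1, b.2} := by
    ext i
    obtain ⟨b, ⟨hb, hbi⟩, -⟩ := h2 i
    simp only [Finset.mem_univ, Finset.mem_biUnion, Finset.mem_insert,
      Finset.mem_singleton, true_iff]
    exact ⟨b, hb, hbi.imp Eq.symm Eq.symm⟩
  have hc := Finset.card_biUnion (s := q) (t := fun b => ({b.1, b.2} : Finset (Fin m))) (by
    intro b hb c hc hbc
    refine Finset.disjoint_left.2 fun i hi hi' => ?_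
    simp only [Finset.mem_insert, Finset.mem_singleton] at hi hi'
    exact hbc ((h2 i).unique ⟨hb, hi.imp Eq.symm Eq.symm⟩ ⟨hc, hi'.imp Eq.symm Eq.symm⟩))
  rw [← hU, Finset.card_univ, Fintype.card_fin,
    Finset.sum_congr rfl (fun b hb => Finset.card_pair (h1 b hb).ne)] at hc
  rw [Finset.sum_const, smul_eq_mul, mul_two] at hc
  exact ⟨q.card, hc⟩

lemma Matches.eq_of_mem {S : Set ℝ} {Q : Finset (ℝ × ℝ)} (hQ : Matches S Q) {a b : ℝ × ℝ}
    (ha : a ∈ Q) (hb : b ∈ Q) {x : ℝ} (hax : a.1 = x ∨ a.2 = x) (hbx : b.1 = x ∨ b.2 = x) :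
    a = b := by
  have hx : x ∈ S := by
    rcases hax with rfl | rfl
    exacts [(hQ.1 a ha).2.1, (hQ.1 a ha).2.2]
  exact (hQ.2 x hx).unique ⟨ha, hax⟩ ⟨hb, hbx⟩

lemma Matches.eq_endpoints {S : Set ℝ} {Q : Finset (ℝ × ℝ)} (hQ : Matches S Q) :
    S = {x | ∃ a ∈ Q, a.1 = x ∨ a.2 = x} := by
  ext x
  constructor
  · intro hx
    obtain ⟨a, ⟨ha, hax⟩, -⟩ := hQ.2 x hx
    exact ⟨a, ha, hax⟩
  · rintro ⟨a, ha, rfl | rfl⟩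
    exacts [(hQ.1 a ha).2.1, (hQ.1 a ha).2.2]

/-- A subset of a matching matches any set that its pairs respect and cover. -/
lemma Matches.subset {S T : Set ℝ} {Q R : Finset (ℝ × ℝ)} (hQ : Matches S Q) (hR : R ⊆ Q)
    (hT : ∀ a ∈ R, a.1 ∈ T ∧ a.2 ∈ T) (hc : ∀ x ∈ T, ∃ a ∈ R, a.1 = x ∨ a.2 = x) :
    Matches T R := by
  refine ⟨fun a ha => ⟨(hQ.1 a (hR ha)).1, hT a ha⟩, fun x hx => ?_⟩
  obtain ⟨a, ha, hax⟩ := hc x hx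
  exact ⟨a, ⟨ha, hax⟩, fun b hb => hQ.eq_of_mem (hR hb.1) (hR ha) hb.2 hax⟩

lemma Matches.union {S T : Set ℝ} {Q R : Finset (ℝ × ℝ)} (hQ : Matches S Q)
    (hR : Matches T R) (hST : Disjoint S T) : Matches (S ∪ T) (Q ∪ R) := by
  rw [Set.disjoint_left] at hST
  constructor
  · intro a ha
    rcases Finset.mem_union.1 ha with h | h
    · exact ⟨(hQ.1 a h).1, Or.inl (hQ.1 a h).2.1, Or.inl (hQ.1 a h).2.2⟩
    · exact ⟨(hR.1 a h).1, Or.inr (hR.1 a h).2.1, Or.inr (hR.1 a h).2.2⟩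
  · rintro x (hx | hx)
    · obtain ⟨a, ⟨ha, hax⟩, hu⟩ := hQ.2 x hx
      refine ⟨a, ⟨Finset.mem_union_left _ ha, hax⟩, ?_⟩
      rintro b ⟨hb, hbx⟩
      rcases Finset.mem_union.1 hb with h | h
      · exact hu b ⟨h, hbx⟩
      · exact absurd (by rcases hbx with rfl | rfl; exacts [(hR.1 b h).2.1, (hR.1 b h).2.2])
          (hST hx)
    · obtain ⟨a, ⟨ha, hax⟩, hu⟩ := hR.2 x hx
      refine ⟨a, ⟨Finset.mem_union_right _ ha, hax⟩, ?_⟩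
      rintro b ⟨hb, hbx⟩
      rcases Finset.mem_union.1 hb with h | h
      · exact absurd hx
          (hST (by rcases hbx with rfl | rfl; exacts [(hQ.1 b h).2.1, (hQ.1 b h).2.2]))
      · exact hu b ⟨h, hbx⟩

lemma Matches.biUnion {ι : Type*} {I : Finset ι} {S : ι → Set ℝ} {Q : ι → Finset (ℝ × ℝ)}
    (hQ : ∀ k ∈ I, Matches (S k) (Q k))
    (hS : ∀ k l, ∀ x ∈ S k, x ∈ S l → k = l) :
    Matches (⋃ k ∈ I, S k) (I.biUnion Q) := by
  constructor
  · intro a ha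
    obtain ⟨k, hk, hak⟩ := Finset.mem_biUnion.1 ha
    obtain ⟨h1, h2, h3⟩ := (hQ k hk).1 a hak
    exact ⟨h1, Set.mem_iUnion₂.2 ⟨k, hk, h2⟩, Set.mem_iUnion₂.2 ⟨k, hk, h3⟩⟩
  · intro x hx
    obtain ⟨k, hk, hxk⟩ := Set.mem_iUnion₂.1 hx
    obtain ⟨a, ⟨ha, hax⟩, hu⟩ := (hQ k hk).2 x hxk
    refine ⟨a, ⟨Finset.mem_biUnion.2 ⟨k, hk, ha⟩, hax⟩, ?_⟩
    rintro b ⟨hb, hbx⟩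
    obtain ⟨l, hl, hbl⟩ := Finset.mem_biUnion.1 hb
    have hxl : x ∈ S l := by
      rcases hbx with rfl | rfl
      exacts [((hQ l hl).1 b hbl).2.1, ((hQ l hl).1 b hbl).2.2]
    obtain rfl := hS k l x hxk hxl
    exact hu b ⟨hbl, hbx⟩

end Matchings

section ProperPart

lemma LinkedPair.symm {a b : ℝ × ℝ} (h : LinkedPair a b) : LinkedPair b a := Or.symm h

lemma mem_component {Q : Finset (ℝ × ℝ)} {a b : ℝ × ℝ} :
    b ∈ component Q a ↔ b ∈ Q ∧
      Relation.ReflTransGen (fun x y => x ∈ Q ∧ y ∈ Q ∧ LinkedPair x y) a b :=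
  Finset.mem_filter

lemma properPart_subset (Sarr : ℝ) (Q : Finset (ℝ × ℝ)) : properPart Sarr Q ⊆ Q :=
  Finset.filter_subset _ _

lemma mem_properPart_of_le {Sarr : ℝ} {Q : Finset (ℝ × ℝ)} {a : ℝ × ℝ} (ha : a ∈ Q)
    (h : Sarr ≤ a.1 ∨ Sarr ≤ a.2) : a ∈ properPart Sarr Q :=
  Finset.mem_filter.2 ⟨ha, a, mem_component.2 ⟨ha, .refl⟩, h⟩

lemma mem_properPart_of_linked {Sarr : ℝ} {Q : Finset (ℝ × ℝ)} {a b : ℝ × ℝ}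
    (ha : a ∈ properPart Sarr Q) (hb : b ∈ Q) (hab : LinkedPair a b) :
    b ∈ properPart Sarr Q := by
  obtain ⟨haQ, c, hc, h⟩ := Finset.mem_filter.1 ha
  obtain ⟨hcQ, hc⟩ := mem_component.1 hc
  exact Finset.mem_filter.2 ⟨hb, c, mem_component.2 ⟨hcQ, hc.head ⟨hb, haQ, hab.symm⟩⟩, h⟩

lemma inchwormProper_properPart (Sarr : ℝ) (Q : Finset (ℝ × ℝ)) :
    InchwormProper Sarr (properPart Sarr Q) := by
  intro a ha
  obtain ⟨-, c, hc, h⟩ := Finset.mem_filter.1 ha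
  replace hc := (mem_component.1 hc).2
  refine ⟨c, mem_component.2 ?_, h⟩
  clear h
  induction hc with
  | refl => exact ⟨ha, .refl⟩
  | tail _ hbc ih =>
    have := mem_properPart_of_linked ih.1 hbc.2.1 hbc.2.2
    exact ⟨this, ih.2.tail ⟨ih.1, this, hbc.2.2⟩⟩

/-- Adding pairs below `Sarr` that are not linked to an inchworm proper set does not change
the proper part. -/
lemma properPart_union {Sarr : ℝ} {q r : Finset (ℝ × ℝ)} (hq : InchwormProper Sarr q)
    (hr : ∀ a ∈ r, a.1 < Sarr ∧ a.2 < Sarr) (hqr : ¬ LinkedSets q r) :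
    properPart Sarr (q ∪ r) = q := by
  ext a
  constructor
  · intro ha
    obtain ⟨haQ, c, hc, h⟩ := Finset.mem_filter.1 ha
    replace hc := (mem_component.1 hc).2
    by_contra haq
    have har : a ∈ r := (Finset.mem_union.1 haQ).resolve_left haq
    have hcr : c ∈ r := by
      clear h
      induction hc with
      | refl => exact har
      | tail _ hbc ih =>
        exact (Finset.mem_union.1 hbc.2.1).resolve_left
          fun hcq => hqr ⟨_, hcq, _, ih, hbc.2.2.symm⟩
    have := hr c hcr
    rcases h with h | h <;> linarith
  · intro ha
    obtain ⟨c, hc, h⟩ := hq a ha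
    obtain ⟨hcq, hc⟩ := mem_component.1 hc
    refine Finset.mem_filter.2 ⟨Finset.mem_union_left _ ha, c, mem_component.2
      ⟨Finset.mem_union_left _ hcq, Relation.ReflTransGen.mono (fun x y hxy => ?_) _ _ hc⟩, h⟩
    exact ⟨Finset.mem_union_left _ hxy.1, Finset.mem_union_left _ hxy.2.1, hxy.2.2⟩

/-- No endpoint of the proper part separates the endpoints of a pair outside of it. -/
lemma not_between_of_notMem_properPart {Sarr : ℝ} {S : Set ℝ} {Q : Finset (ℝ × ℝ)}
    (hQ : Matches S Q) {a c : ℝ × ℝ} (ha : a ∈ Q) (haM : a ∉ properPart Sarr Q)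
    (hc : c ∈ properPart Sarr Q) {x : ℝ} (hcx : c.1 = x ∨ c.2 = x) :
    ¬ (a.1 < x ∧ x < a.2) := by
  rintro ⟨h1, h2⟩
  have key : ∀ d ∈ properPart Sarr Q, ((a.1 < d.1 ∧ d.1 < a.2) ∨ (a.1 < d.2 ∧ d.2 < a.2)) →
      a.1 < d.1 ∧ d.2 < a.2 := by
    intro d hd hda
    have hnl : ¬ LinkedPair d a := fun h => haM (mem_properPart_of_linked hd ha h)
    have hlt := (hQ.1 d (properPart_subset _ _ hd)).1
    unfold LinkedPair at hnl
    push Not at hnl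
    by_contra hcon
    rw [not_and_or, not_lt, not_lt] at hcon
    rcases hda with h | h <;> rcases hcon with h' | h' <;>
      first
      | linarith
      | exact absurd (hnl.1 (by linarith) (by linarith)) (by linarith)
      | exact absurd (hnl.2 (by linarith) (by linarith)) (by linarith)
  have hcin : a.1 < c.1 ∧ c.2 < a.2 := key c hc (by
    rcases hcx with rfl | rfl
    exacts [Or.inl ⟨h1, h2⟩, Or.inr ⟨h1, h2⟩])
  obtain ⟨-, e, he, hle⟩ := Finset.mem_filter.1 hc
  replace he := (mem_component.1 he).2
  have hein : e ∈ properPart Sarr Q ∧ a.1 < e.1 ∧ e.2 < a.2 := by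
    clear hle
    induction he with
    | refl => exact ⟨hc, hcin⟩
    | @tail d e _ hde ih =>
      have heM := mem_properPart_of_linked ih.1 hde.2.1 hde.2.2
      have hd := (hQ.1 _ hde.1).1
      have he := (hQ.1 _ hde.2.1).1
      refine ⟨heM, key e heM ?_⟩
      rcases hde.2.2 with h | h
      · exact Or.inl ⟨by linarith, by linarith⟩
      · exact Or.inr ⟨by linarith, by linarith⟩
  have := (hQ.1 _ (properPart_subset _ _ hein.1)).1
  refine haM (mem_properPart_of_le ha (Or.inr ?_))
  rcases hle with h | h <;> linarith

end ProperPart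

section Positions

lemma padR_of_lt {m : ℕ} (s : Fin m → ℝ) {i : ℕ} (h : i < m) : padR s i = s ⟨i, h⟩ :=
  dif_pos h

lemma padN_fin {p : ℕ} (n : Fin p → ℕ) (k : Fin p) : padN n k = n k := dif_pos k.2

lemma strictMonoOn_padR {m : ℕ} {s : Fin m → ℝ} (hs : StrictMono s) :
    StrictMonoOn (padR s) (Set.Iio m) := by
  intro i hi j hj hij
  rw [padR_of_lt s hi, padR_of_lt s hj]
  exact hs hij

lemma range_eq_image_padR {m : ℕ} (s : Fin m → ℝ) : Set.range s = padR s '' Set.Iio m := by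
  ext x
  constructor
  · rintro ⟨i, rfl⟩
    exact ⟨i, i.2, padR_of_lt s i.2⟩
  · rintro ⟨i, hi, rfl⟩
    exact ⟨⟨i, hi⟩, (padR_of_lt s hi).symm⟩

variable {p : ℕ} (n : Fin (p + 1) → ℕ)

lemma blockStart_zero : blockStart n 0 = 0 := by simp [blockStart]

lemma blockStart_succ (k : ℕ) : blockStart n (k + 1) = blockStart n k + padN n k + 1 := by
  simp only [blockStart, Finset.sum_range_succ]
  ring

lemma strictMono_blockStart : StrictMono (blockStart n) :=
  strictMono_nat_of_lt_succ fun k => by rw [blockStart_succ]; omega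

lemma blockStart_last {p' : ℕ} (hp : p ≤ p') (hn : ∑ k, n k = p' - p) :
    blockStart n (p + 1) = p' + 1 := by
  have : ∑ j ∈ Finset.range (p + 1), padN n j = ∑ k, n k := by
    rw [Finset.sum_range]
    exact Finset.sum_congr rfl fun k _ => padN_fin n k
  rw [blockStart, this, hn]
  omega

lemma mainPos_of_lt {p' i : ℕ} (hi : i < p) : mainPos p' n i = blockStart n i + padN n i := by
  rw [mainPos, if_pos hi, Finset.sum_range_succ, blockStart]
  ring

lemma mainPos_of_le {p' i : ℕ} (hi : p ≤ i) : mainPos p' n i = p' + (i - p) :=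
  if_neg (by omega)

lemma mainPos_lt {p' i : ℕ} (hp : p ≤ p') (hn : ∑ k, n k = p' - p) (hi : i < p) :
    mainPos p' n i < p' := by
  have h1 := blockStart_last n hp hn
  have h2 := strictMono_blockStart n (show i + 1 < p + 1 by omega)
  rw [blockStart_succ] at h2
  rw [mainPos_of_lt n hi]
  omega

lemma strictMono_mainPos {p' : ℕ} (hp : p ≤ p') (hn : ∑ k, n k = p' - p) :
    StrictMono (mainPos p' n) := by
  refine strictMono_nat_of_lt_succ fun i => ?_
  rcases lt_or_ge (i + 1) p with h | h
  · rw [mainPos_of_lt n h, mainPos_of_lt n (by omega), blockStart_succ]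
    omega
  · rcases lt_or_ge i p with h' | h'
    · have := mainPos_lt n hp hn h'
      rw [mainPos_of_le n h]
      omega
    · rw [mainPos_of_le n h, mainPos_of_le n h']
      omega

lemma exists_blockStart_le (x : ℕ) : ∃ k, blockStart n k ≤ x ∧ x < blockStart n (k + 1) := by
  induction x with
  | zero => exact ⟨0, by rw [blockStart_zero], by rw [blockStart_succ]; omega⟩
  | succ x ih =>
    obtain ⟨k, h1, h2⟩ := ih
    rcases lt_or_ge (x + 1) (blockStart n (k + 1)) with h | h
    · exact ⟨k, by omega, h⟩
    · exact ⟨k + 1, h, by have := blockStart_succ n (k + 1); omega⟩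

/-- Every position below `p'` is a main position or lies in a block. -/
lemma mainPos_or_block {p' x : ℕ} (hp : p ≤ p') (hn : ∑ k, n k = p' - p) (hx : x < p') :
    (∃ i < p, x = mainPos p' n i) ∨ ∃ k : Fin (p + 1), ∃ r < n k, x = blockStart n k + r := by
  obtain ⟨k, h1, h2⟩ := exists_blockStart_le n x
  have hl := blockStart_last n hp hn
  have hk : k < p + 1 := by
    by_contra h
    have := (strictMono_blockStart n).monotone (show p + 1 ≤ k by omega)
    omega
  rw [blockStart_succ] at h2
  rcases lt_or_ge x (blockStart n k + padN n k) with h | h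
  · refine Or.inr ⟨⟨k, hk⟩, x - blockStart n k, ?_, ?_⟩
    · rw [← padN_fin n ⟨k, hk⟩]
      simp only
      omega
    · simp only
      omega
  · have hkp : k < p := by
      by_contra hcon
      obtain rfl : k = p := by omega
      rw [blockStart_succ] at hl
      omega
    exact Or.inl ⟨k, hkp, by rw [mainPos_of_lt n hkp]; omega⟩

lemma block_lt {p' : ℕ} (hp : p ≤ p') (hn : ∑ k, n k = p' - p) (k : Fin (p + 1)) {r : ℕ}
    (hr : r < n k) : blockStart n k + r < p' := by
  have h1 := blockStart_last n hp hn
  have h2 := (strictMono_blockStart n).monotone (show (k : ℕ) + 1 ≤ p + 1 by omega)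
  rw [blockStart_succ, padN_fin] at h2
  omega

lemma mainPos_lt_or_gt {p' : ℕ} (hp : p ≤ p') (hn : ∑ k, n k = p' - p) (i : ℕ)
    (k : Fin (p + 1)) :
    mainPos p' n i < blockStart n k ∨ blockStart n k + n k ≤ mainPos p' n i := by
  rcases lt_or_ge i p with h | h
  · rw [mainPos_of_lt n h, ← padN_fin n k]
    rcases lt_trichotomy i k with h' | h' | h'
    · have := (strictMono_blockStart n).monotone (show i + 1 ≤ k by omega)
      rw [blockStart_succ] at this
      omega
    · rw [h']
      omega
    · have := (strictMono_blockStart n).monotone (show (k : ℕ) + 1 ≤ i by omega)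
      rw [blockStart_succ] at this
      omega
  · have h1 := blockStart_last n hp hn
    have h2 := (strictMono_blockStart n).monotone (show (k : ℕ) + 1 ≤ p + 1 by omega)
    rw [blockStart_succ, padN_fin] at h2
    rw [mainPos_of_le n h]
    omega

lemma block_unique {k l : Fin (p + 1)} {r t : ℕ} (hr : r < n k) (ht : t < n l)
    (h : blockStart n k + r = blockStart n l + t) : k = l := by
  rw [← padN_fin n k] at hr
  rw [← padN_fin n l] at ht
  rcases lt_trichotomy (k : ℕ) l with h' | h' | h'
  · have := (strictMono_blockStart n).monotone (show (k : ℕ) + 1 ≤ l by omega)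
    rw [blockStart_succ] at this
    omega
  · exact Fin.ext h'
  · have := (strictMono_blockStart n).monotone (show (l : ℕ) + 1 ≤ k by omega)
    rw [blockStart_succ] at this
    omega

variable {n}

/-- The block lengths are determined by the main positions. -/
lemma eq_of_mainPos_eq {n' : Fin (p + 1) → ℕ} {p' : ℕ} (hp : p ≤ p')
    (hn : ∑ k, n k = p' - p) (hn' : ∑ k, n' k = p' - p)
    (h : ∀ i < p, mainPos p' n i = mainPos p' n' i) : n = n' := by
  have hB : ∀ k ≤ p + 1, blockStart n k = blockStart n' k := by
    intro k hk
    rcases k with _ | k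
    · rw [blockStart_zero, blockStart_zero]
    · rcases lt_or_ge k p with hkp | hkp
      · have := h k hkp
        rw [mainPos_of_lt n hkp, mainPos_of_lt n' hkp] at this
        rw [blockStart_succ, blockStart_succ, this]
      · obtain rfl : k = p := by omega
        rw [blockStart_last n hp hn, blockStart_last n' hp hn']
  ext k
  have h1 := hB k (by omega)
  have h2 := hB (k + 1) (by omega)
  rw [blockStart_succ, blockStart_succ, padN_fin, padN_fin] at h2
  omega

/-- Every set of low positions is the set of low main positions for some block lengths. -/
lemma exists_lengths {p' : ℕ} (X : Finset ℕ) (hX : ∀ x ∈ X, x < p') :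
    ∃ n : Fin (X.card + 1) → ℕ, X.card ≤ p' ∧ ∑ k, n k = p' - X.card ∧
      ∀ x, x ∈ X ↔ ∃ i < X.card, x = mainPos p' n i := by
  set p := X.card with hpdef
  have hcard : p ≤ p' := by
    simpa using Finset.card_le_card (fun x hx => Finset.mem_range.2 (hX x hx) : X ⊆ Finset.range p')
  let e := X.orderEmbOfFin hpdef.symm
  let c : ℕ → ℕ := fun i => if h : i < p then e ⟨i, h⟩ else p'
  have hc : ∀ i < p, c i < c (i + 1) := by
    intro i hi
    by_cases hi' : i + 1 < p
    · simp only [c, dif_pos hi, dif_pos hi']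
      exact e.strictMono (Fin.mk_lt_mk.2 (Nat.lt_succ_self i))
    · simp only [c, dif_pos hi, dif_neg hi']
      exact hX _ (X.orderEmbOfFin_mem hpdef.symm _)
  let f : ℕ → ℕ := fun k => if k = 0 then c 0 else c k - c (k - 1) - 1
  let n : Fin (p + 1) → ℕ := fun k => f k
  have hpad : ∀ k < p + 1, padN n k = f k := fun k hk => padN_fin n ⟨k, hk⟩
  have hB : ∀ k < p + 1, blockStart n (k + 1) = c k + 1 := by
    intro k
    induction k with
    | zero =>
      intro hk
      rw [blockStart_succ, blockStart_zero, hpad 0 hk]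
      simp [f]
    | succ k ih =>
      intro hk
      have := hc k (by omega)
      rw [blockStart_succ, ih (by omega), hpad (k + 1) hk]
      simp only [f, Nat.succ_ne_zero, if_false, Nat.add_sub_cancel]
      omega
  have hsum : ∑ k, n k = p' - p := by
    have h1 := hB p (by omega)
    have h2 : ∑ j ∈ Finset.range (p + 1), padN n j = ∑ k, n k := by
      rw [Finset.sum_range]
      exact Finset.sum_congr rfl fun k _ => padN_fin n k
    rw [blockStart, h2] at h1
    simp only [c, lt_irrefl, dif_neg, not_false_eq_true] at h1
    omega
  have hmain : ∀ i (hi : i < p), mainPos p' n i = e ⟨i, hi⟩ := by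
    intro i hi
    have h1 := hB i (by omega)
    rw [blockStart_succ] at h1
    simp only [c, dif_pos hi] at h1
    rw [mainPos_of_lt n hi]
    omega
  refine ⟨n, hcard, hsum, fun x => ?_⟩
  have hr : x ∈ X ↔ x ∈ Set.range e := by
    rw [Finset.range_orderEmbOfFin]
    exact Finset.mem_coe.symm
  rw [hr]
  constructor
  · rintro ⟨i, rfl⟩
    exact ⟨i, i.2, (hmain i i.2).symm⟩
  · rintro ⟨i, hi, rfl⟩
    exact ⟨⟨i, hi⟩, (hmain i hi).symm⟩

end Positions

section Sequences

variable {m' p' p : ℕ} {s' : Fin m' → ℝ} {n : Fin (p + 1) → ℕ}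

lemma mainSeq_apply {m : ℕ} (i : Fin m) :
    mainSeq s' p' p n m i = padR s' (mainPos p' n i) := by
  rw [mainSeq, mainPos]
  split_ifs <;> rfl

lemma blockSeq_apply (k : Fin (p + 1)) (r : Fin (n k)) :
    blockSeq s' p n k r = padR s' (blockStart n k + r) := rfl

lemma mainPos_lt_length (hp : p' < m') (hpp : p ≤ p') (hn : ∑ k, n k = p' - p)
    {i : ℕ} (hi : i < m' + p - p') : mainPos p' n i < m' := by
  rcases lt_or_ge i p with h | h
  · exact (mainPos_lt n hpp hn h).trans hp
  · rw [mainPos_of_le n h]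
    omega

lemma strictMono_mainSeq (hmono : StrictMono s') (hp : p' < m') (hpp : p ≤ p')
    (hn : ∑ k, n k = p' - p) : StrictMono (mainSeq s' p' p n (m' + p - p')) := by
  intro i j hij
  rw [mainSeq_apply, mainSeq_apply]
  exact strictMonoOn_padR hmono (mainPos_lt_length hp hpp hn i.2)
    (mainPos_lt_length hp hpp hn j.2) (strictMono_mainPos n hpp hn hij)

lemma strictMono_blockSeq (hmono : StrictMono s') (hp : p' < m') (hpp : p ≤ p')
    (hn : ∑ k, n k = p' - p) (k : Fin (p + 1)) : StrictMono (blockSeq s' p n k) := by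
  intro i j hij
  rw [blockSeq_apply, blockSeq_apply]
  exact strictMonoOn_padR hmono ((block_lt n hpp hn k i.2).trans hp)
    ((block_lt n hpp hn k j.2).trans hp) (by omega)

/-- The main points and the blocks together exhaust the combined sequence. -/
lemma range_eq_union (hp : p' < m') (hpp : p ≤ p') (hn : ∑ k, n k = p' - p) :
    Set.range s' = Set.range (mainSeq s' p' p n (m' + p - p')) ∪
      ⋃ k ∈ (Finset.univ : Finset (Fin (p + 1))), Set.range (blockSeq s' p n k) := by
  rw [range_eq_image_padR]
  ext x
  constructor
  · rintro ⟨i, hi, rfl⟩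
    have hi : i < m' := hi
    rcases lt_or_ge i p' with h | h
    · rcases mainPos_or_block n hpp hn h with ⟨j, hj, rfl⟩ | ⟨k, r, hr, rfl⟩
      · exact Or.inl ⟨⟨j, by omega⟩, mainSeq_apply _⟩
      · exact Or.inr (Set.mem_iUnion₂.2 ⟨k, Finset.mem_univ k, ⟨r, hr⟩, rfl⟩)
    · refine Or.inl ⟨⟨i - p' + p, by omega⟩, ?_⟩
      rw [mainSeq_apply, mainPos_of_le n (by simp)]
      congr 1
      simp only
      omega
  · rintro (⟨i, rfl⟩ | h)
    · exact ⟨_, mainPos_lt_length hp hpp hn i.2, (mainSeq_apply i).symm⟩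
    · obtain ⟨k, -, r, rfl⟩ := Set.mem_iUnion₂.1 h
      exact ⟨_, (block_lt n hpp hn k r.2).trans hp, rfl⟩

lemma mainSeq_lt_or_gt (hmono : StrictMono s') (hp : p' < m') (hpp : p ≤ p')
    (hn : ∑ k, n k = p' - p) (i : Fin (m' + p - p')) (k : Fin (p + 1)) :
    (∀ r, mainSeq s' p' p n _ i < blockSeq s' p n k r) ∨
      ∀ r, blockSeq s' p n k r < mainSeq s' p' p n _ i := by
  have hi := mainPos_lt_length hp hpp hn i.2
  refine (mainPos_lt_or_gt n hpp hn i k).imp (fun h r => ?_) (fun h r => ?_)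
  · rw [mainSeq_apply, blockSeq_apply]
    exact strictMonoOn_padR hmono hi ((block_lt n hpp hn k r.2).trans hp) (by omega)
  · rw [mainSeq_apply, blockSeq_apply]
    exact strictMonoOn_padR hmono ((block_lt n hpp hn k r.2).trans hp) hi (by omega)

lemma blockSeq_index_unique (hmono : StrictMono s') (hp : p' < m') (hpp : p ≤ p')
    (hn : ∑ k, n k = p' - p) (k l : Fin (p + 1)) (x : ℝ)
    (hk : x ∈ Set.range (blockSeq s' p n k)) (hl : x ∈ Set.range (blockSeq s' p n l)) :
    k = l := by
  obtain ⟨r, rfl⟩ := hk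
  obtain ⟨t, ht⟩ := hl
  exact block_unique n r.2 t.2 ((strictMonoOn_padR hmono).injOn
    ((block_lt n hpp hn k r.2).trans hp) ((block_lt n hpp hn l t.2).trans hp) ht.symm)

lemma disjoint_main_blocks (hmono : StrictMono s') (hp : p' < m') (hpp : p ≤ p')
    (hn : ∑ k, n k = p' - p) :
    Disjoint (Set.range (mainSeq s' p' p n (m' + p - p')))
      (⋃ k ∈ (Finset.univ : Finset (Fin (p + 1))), Set.range (blockSeq s' p n k)) := by
  rw [Set.disjoint_left]
  rintro _ ⟨i, rfl⟩ h
  obtain ⟨k, -, r, hr⟩ := Set.mem_iUnion₂.1 h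
  rcases mainSeq_lt_or_gt hmono hp hpp hn i k with h | h
  · exact (h r).ne hr.symm
  · exact (h r).ne hr

lemma blockSeq_lt {Sarr : ℝ} (hp : p' < m') (hpp : p ≤ p') (hn : ∑ k, n k = p' - p)
    (hlow : ∀ i : Fin m', (i : ℕ) < p' → s' i < Sarr) (k : Fin (p + 1)) (r : Fin (n k)) :
    blockSeq s' p n k r < Sarr := by
  have h := block_lt n hpp hn k r.2
  rw [blockSeq_apply, padR_of_lt s' (h.trans hp)]
  exact hlow _ h

end Sequences

section Decomposition

variable {Sarr : ℝ} {m' p' : ℕ} {s' : Fin m' → ℝ}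

lemma mem_decompSet {d : DecompTuple m' p'} :
    d ∈ decompSet Sarr p' s' ↔ d.1 ≤ p' ∧ Even (p' - d.1) ∧ (∀ k, Even (d.2.1 k)) ∧
      (∑ k, d.2.1 k) = p' - d.1 ∧
      (d.2.2.1 ∈ pairings (m' + d.1 - p') ∧
        InchwormProper Sarr (realize (mainSeq s' p' d.1 d.2.1 (m' + d.1 - p')) d.2.2.1)) ∧
      ∀ k, d.2.2.2 k ∈ pairings (d.2.1 k) := by
  rw [decompSet, Set.mem_ofPred_eq, inchwormPairings, Finset.mem_filter]

lemma matches_decompMap (hp : p' < m') (hmono : StrictMono s') {d : DecompTuple m' p'}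
    (hd : d ∈ decompSet Sarr p' s') : Matches (Set.range s') (decompMap p' s' d) := by
  obtain ⟨hpp, -, -, hn, hq, hqs⟩ := mem_decompSet.1 hd
  rw [range_eq_union hp hpp hn]
  exact (matches_realize (strictMono_mainSeq hmono hp hpp hn) hq.1).union
    (Matches.biUnion (fun k _ => matches_realize (strictMono_blockSeq hmono hp hpp hn k) (hqs k))
      (blockSeq_index_unique hmono hp hpp hn)) (disjoint_main_blocks hmono hp hpp hn)

lemma properPart_decompMap (hp : p' < m') (hmono : StrictMono s')
    (hlow : ∀ i : Fin m', (i : ℕ) < p' → s' i < Sarr) {d : DecompTuple m' p'}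
    (hd : d ∈ decompSet Sarr p' s') :
    properPart Sarr (decompMap p' s' d) =
      realize (mainSeq s' p' d.1 d.2.1 (m' + d.1 - p')) d.2.2.1 := by
  obtain ⟨hpp, -, -, hn, hq, hqs⟩ := mem_decompSet.1 hd
  have hblock : ∀ a ∈ Finset.univ.biUnion fun k => realize (blockSeq s' d.1 d.2.1 k) (d.2.2.2 k),
      ∃ k i j, a = (blockSeq s' d.1 d.2.1 k i, blockSeq s' d.1 d.2.1 k j) := by
    intro a ha
    obtain ⟨k, -, hk⟩ := Finset.mem_biUnion.1 ha
    obtain ⟨b, -, rfl⟩ := Finset.mem_image.1 hk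
    exact ⟨k, _, _, rfl⟩
  refine properPart_union hq.2 ?_ ?_
  · intro a ha
    obtain ⟨k, i, j, rfl⟩ := hblock a ha
    exact ⟨blockSeq_lt hp hpp hn hlow k i, blockSeq_lt hp hpp hn hlow k j⟩
  · rintro ⟨a, ha, b, hb, hab⟩
    obtain ⟨k, i, j, rfl⟩ := hblock b hb
    obtain ⟨c, -, rfl⟩ := Finset.mem_image.1 ha
    have h1 := mainSeq_lt_or_gt hmono hp hpp hn c.1 k
    have h2 := mainSeq_lt_or_gt hmono hp hpp hn c.2 k
    unfold LinkedPair at hab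
    simp only at hab
    rcases h1 with h1 | h1 <;> rcases h2 with h2 | h2 <;>
      have := h1 i <;> have := h1 j <;> have := h2 i <;> have := h2 j <;>
      rcases hab with h | h <;> linarith

lemma realize_block_eq_filter (hp : p' < m') (hmono : StrictMono s') {d : DecompTuple m' p'}
    (hd : d ∈ decompSet Sarr p' s') (k : Fin (d.1 + 1)) :
    realize (blockSeq s' d.1 d.2.1 k) (d.2.2.2 k) =
      (decompMap p' s' d).filter fun a => a.1 ∈ Set.range (blockSeq s' d.1 d.2.1 k) := by
  obtain ⟨hpp, -, -, hn, -, -⟩ := mem_decompSet.1 hd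
  ext a
  rw [Finset.mem_filter, decompMap, Finset.mem_union, Finset.mem_biUnion]
  constructor
  · intro ha
    refine ⟨Or.inr ⟨k, Finset.mem_univ k, ha⟩, ?_⟩
    obtain ⟨b, -, rfl⟩ := Finset.mem_image.1 ha
    exact ⟨_, rfl⟩
  · rintro ⟨ha | ⟨l, -, hl⟩, hak⟩
    · obtain ⟨b, -, rfl⟩ := Finset.mem_image.1 ha
      exact absurd (Set.mem_iUnion₂.2 ⟨k, Finset.mem_univ k, hak⟩)
        (Set.disjoint_left.1 (disjoint_main_blocks hmono hp hpp hn) ⟨b.1, rfl⟩)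
    · have hal : a.1 ∈ Set.range (blockSeq s' d.1 d.2.1 l) := by
        obtain ⟨b, -, rfl⟩ := Finset.mem_image.1 hl
        exact ⟨_, rfl⟩
      rwa [blockSeq_index_unique hmono hp hpp hn k l _ hak hal]

lemma injOn_decompMap (hp : p' < m') (hmono : StrictMono s')
    (hlow : ∀ i : Fin m', (i : ℕ) < p' → s' i < Sarr) :
    Set.InjOn (decompMap p' s') (decompSet Sarr p' s') := by
  intro d hd d' hd' h
  have hmain : realize (mainSeq s' p' d.1 d.2.1 (m' + d.1 - p')) d.2.2.1 =
      realize (mainSeq s' p' d'.1 d'.2.1 (m' + d'.1 - p')) d'.2.2.1 := by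
    rw [← properPart_decompMap hp hmono hlow hd, h, properPart_decompMap hp hmono hlow hd']
  have hb := realize_block_eq_filter hp hmono hd
  have hb' := realize_block_eq_filter hp hmono hd'
  rw [h] at hb
  obtain ⟨hpp, -, -, hn, hq, -⟩ := mem_decompSet.1 hd
  obtain ⟨hpp', -, -, hn', hq', -⟩ := mem_decompSet.1 hd'
  clear hd hd'
  generalize decompMap p' s' d' = Q at hb hb'
  clear h
  obtain ⟨p, n, q, qs⟩ := d
  obtain ⟨r, n', q', qs'⟩ := d'
  simp only at *
  have hs := strictMono_mainSeq hmono hp hpp hn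
  have hs' := strictMono_mainSeq hmono hp hpp' hn'
  have hrange : Set.range (mainSeq s' p' p n (m' + p - p')) =
      Set.range (mainSeq s' p' r n' (m' + r - p')) := by
    rw [(matches_realize hs hq.1).eq_endpoints, hmain, ← (matches_realize hs' hq'.1).eq_endpoints]
  have hcard : m' + p - p' = m' + r - p' := by
    have := congrArg Set.ncard hrange
    rwa [Set.ncard_range_of_injective hs.injective, Set.ncard_range_of_injective hs'.injective,
      Nat.card_fin, Nat.card_fin] at this
  obtain rfl : p = r := by omega
  have hseq := (StrictMono.range_inj hs hs').1 hrange
  obtain rfl : n = n' := by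
    refine eq_of_mainPos_eq hpp hn hn' fun i hi => ?_
    have := congrFun hseq ⟨i, by omega⟩
    rw [mainSeq_apply, mainSeq_apply] at this
    exact (strictMonoOn_padR hmono).injOn (mainPos_lt_length hp hpp hn (by omega))
      (mainPos_lt_length hp hpp hn' (by omega)) this
  obtain rfl := realize_injective hs.injective hmain
  obtain rfl : qs = qs' := by
    funext k
    exact realize_injective (strictMono_blockSeq hmono hp hpp hn k).injective
      ((hb k).trans (hb' k).symm)
  rfl

lemma exists_decomp (hp : p' < m') (hmono : StrictMono s')
    (hup : ∀ i : Fin m', p' ≤ (i : ℕ) → Sarr < s' i) {Q : Finset (ℝ × ℝ)}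
    (hQ : Matches (Set.range s') Q) : ∃ d ∈ decompSet Sarr p' s', decompMap p' s' d = Q := by
  set M := properPart Sarr Q with hM
  have hMQ : M ⊆ Q := properPart_subset _ _
  obtain ⟨n, hpp, hn, hX⟩ := exists_lengths (p' := p')
    ((Finset.range p').filter fun i => ∃ a ∈ M, a.1 = padR s' i ∨ a.2 = padR s' i)
    (fun x hx => Finset.mem_range.1 (Finset.mem_filter.1 hx).1)
  generalize hcard : (Finset.card _) = p at n hpp hn hX
  have hs := strictMono_mainSeq hmono hp hpp hn
  -- the main points are exactly the endpoints of the proper part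
  have hmain : ∀ x ∈ Set.range s', x ∈ Set.range (mainSeq s' p' p n (m' + p - p')) ↔
      ∃ a ∈ M, a.1 = x ∨ a.2 = x := by
    rintro _ ⟨i, rfl⟩
    rcases lt_or_ge (i : ℕ) p' with hi | hi
    · have := hX i
      rw [Finset.mem_filter, Finset.mem_range, padR_of_lt s' i.2] at this
      simp only [hi, true_and, Fin.eta] at this
      rw [this]
      constructor
      · rintro ⟨j, hj⟩
        rw [mainSeq_apply, ← padR_of_lt s' i.2] at hj
        have hij := (strictMonoOn_padR hmono).injOn (mainPos_lt_length hp hpp hn j.2) i.2 hj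
        refine ⟨j, ?_, hij.symm⟩
        by_contra hcon
        rw [mainPos_of_le n (by omega)] at hij
        omega
      · rintro ⟨j, hj, hij⟩
        refine ⟨⟨j, by omega⟩, ?_⟩
        rw [mainSeq_apply, ← hij, padR_of_lt s' i.2]
    · refine iff_of_true ⟨⟨i - p' + p, by omega⟩, ?_⟩ ?_
      · rw [mainSeq_apply, mainPos_of_le n (by simp), ← padR_of_lt s' i.2]
        congr 1
        simp only
        omega
      · obtain ⟨a, ⟨ha, hai⟩, -⟩ := hQ.2 (s' i) ⟨i, rfl⟩
        have := (hup i hi).le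
        exact ⟨a, mem_properPart_of_le ha (hai.imp (fun h => this.trans_eq h.symm) (fun h => this.trans_eq h.symm)), hai⟩
  have hunion := range_eq_union (s' := s') hp hpp hn
  have hdisj := Set.disjoint_left.1 (disjoint_main_blocks hmono hp hpp hn)
  have hMmatch : Matches (Set.range (mainSeq s' p' p n (m' + p - p'))) M := by
    refine hQ.subset hMQ (fun a ha => ?_) (fun x hx => ?_)
    · have := (hQ.1 a (hMQ ha)).2
      exact ⟨(hmain _ this.1).2 ⟨a, ha, Or.inl rfl⟩, (hmain _ this.2).2 ⟨a, ha, Or.inr rfl⟩⟩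
    · exact (hmain x (hunion ▸ Or.inl hx)).1 hx
  obtain ⟨q, hq, hqM⟩ := exists_realize_of_matches hs hMmatch
  -- endpoints of the remaining pairs lie in blocks
  have hrest : ∀ a ∈ Q, a ∉ M → ∀ x, a.1 = x ∨ a.2 = x →
      ∃ k, x ∈ Set.range (blockSeq s' p n k) := by
    intro a ha haM x hax
    have hx : x ∈ Set.range s' := by
      rcases hax with rfl | rfl
      exacts [(hQ.1 a ha).2.1, (hQ.1 a ha).2.2]
    have hxm : x ∉ Set.range (mainSeq s' p' p n (m' + p - p')) := fun h => by
      obtain ⟨b, hb, hbx⟩ := (hmain x hx).1 h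
      exact haM (hQ.eq_of_mem ha (hMQ hb) hax hbx ▸ hb)
    rw [hunion] at hx
    obtain ⟨k, -, hk⟩ := Set.mem_iUnion₂.1 (hx.resolve_left hxm)
    exact ⟨k, hk⟩
  have hsame : ∀ a ∈ Q, a ∉ M → ∃ k, a.1 ∈ Set.range (blockSeq s' p n k) ∧
      a.2 ∈ Set.range (blockSeq s' p n k) := by
    intro a ha haM
    obtain ⟨k, i, hi⟩ := hrest a ha haM _ (Or.inl rfl)
    obtain ⟨l, j, hj⟩ := hrest a ha haM _ (Or.inr rfl)
    have hlt := (hQ.1 a ha).1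
    have hki := block_lt n hpp hn k i.2
    have hlj := block_lt n hpp hn l j.2
    have hpos : blockStart n k + i < blockStart n l + j := by
      rw [← hi, ← hj, blockSeq_apply, blockSeq_apply] at hlt
      exact (strictMonoOn_padR hmono).lt_iff_lt (hki.trans hp) (hlj.trans hp) |>.1 hlt
    suffices hkl : k = l from ⟨k, ⟨i, hi⟩, hkl ▸ ⟨j, hj⟩⟩
    by_contra hkl
    have hkl' : (k : ℕ) < l := by
      by_contra hcon
      have hlk : (l : ℕ) + 1 ≤ k := by
        have : (k : ℕ) ≠ l := fun h => hkl (Fin.ext h)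
        omega
      have := (strictMono_blockStart n).monotone hlk
      rw [blockStart_succ, padN_fin] at this
      omega
    have hkp : (k : ℕ) < p := by omega
    have hkm : mainPos p' n k < m' := (mainPos_lt n hpp hn hkp).trans hp
    have hkl2 := (strictMono_blockStart n).monotone (show (k : ℕ) + 1 ≤ l by omega)
    rw [blockStart_succ] at hkl2
    have hz : padR s' (mainPos p' n k) ∈ Set.range (mainSeq s' p' p n (m' + p - p')) :=
      ⟨⟨k, by omega⟩, mainSeq_apply _⟩
    obtain ⟨c, hc, hcx⟩ := (hmain _ (hunion ▸ Or.inl hz)).1 hz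
    refine not_between_of_notMem_properPart hQ ha haM hc hcx ⟨?_, ?_⟩
    · rw [← hi, blockSeq_apply]
      refine strictMonoOn_padR hmono (hki.trans hp) hkm ?_
      rw [mainPos_of_lt n hkp, padN_fin]
      omega
    · rw [← hj, blockSeq_apply]
      refine strictMonoOn_padR hmono hkm (hlj.trans hp) ?_
      rw [mainPos_of_lt n hkp]
      omega
  have hblock : ∀ k, Matches (Set.range (blockSeq s' p n k))
      (Q.filter fun a => a.1 ∈ Set.range (blockSeq s' p n k)) := by
    intro k
    have hnotM : ∀ a ∈ Q, ∀ x, (a.1 = x ∨ a.2 = x) → x ∈ Set.range (blockSeq s' p n k) →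
        a ∉ M := by
      intro a ha x hax hx haM
      have hxm : x ∈ Set.range (mainSeq s' p' p n (m' + p - p')) := by
        rw [hMmatch.eq_endpoints]
        exact ⟨a, haM, hax⟩
      exact hdisj hxm (Set.mem_iUnion₂.2 ⟨k, Finset.mem_univ k, hx⟩)
    refine hQ.subset (Finset.filter_subset _ _) (fun a ha => ?_) (fun x hx => ?_)
    · obtain ⟨ha, hak⟩ := Finset.mem_filter.1 ha
      obtain ⟨l, h1, h2⟩ := hsame a ha (hnotM a ha _ (Or.inl rfl) hak)
      obtain rfl := blockSeq_index_unique hmono hp hpp hn k l _ hak h1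
      exact ⟨h1, h2⟩
    · obtain ⟨a, ⟨ha, hax⟩, -⟩ := hQ.2 x (hunion ▸ Or.inr
        (Set.mem_iUnion₂.2 ⟨k, Finset.mem_univ k, hx⟩))
      refine ⟨a, Finset.mem_filter.2 ⟨ha, ?_⟩, hax⟩
      obtain ⟨l, h1, h2⟩ := hsame a ha (hnotM a ha x hax hx)
      have hxl : x ∈ Set.range (blockSeq s' p n l) := by
        rcases hax with rfl | rfl
        exacts [h1, h2]
      obtain rfl := blockSeq_index_unique hmono hp hpp hn k l _ hx hxl
      exact h1
  choose qs hqs hqsQ using fun k =>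
    exists_realize_of_matches (strictMono_blockSeq hmono hp hpp hn k) (hblock k)
  refine ⟨⟨p, n, q, qs⟩, mem_decompSet.2 ⟨hpp, ?_, fun k => even_of_mem_pairings (hqs k), hn,
    ⟨hq, ?_⟩, hqs⟩, ?_⟩
  · rw [← hn]
    exact Finset.even_sum _ fun k _ => even_of_mem_pairings (hqs k)
  · simp only [hqM]
    exact inchwormProper_properPart Sarr Q
  · ext a
    simp only [decompMap, hqM, hqsQ, Finset.mem_union, Finset.mem_biUnion, Finset.mem_univ,
      true_and, Finset.mem_filter]
    constructor
    · rintro (h | ⟨k, h, -⟩)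
      exacts [hMQ h, h]
    · intro ha
      by_cases haM : a ∈ M
      · exact Or.inl haM
      · obtain ⟨k, h1, -⟩ := hsame a ha haM
        exact Or.inr ⟨k, ha, h1⟩

end Decomposition

/-- Let `s'_1 < ⋯ < s'_{m'}` with exactly the lowest `p'` points
below `Sarr` and the rest above.  Then `(p, n, q, q_p, …, q_0) ↦ q ∪ q_p ∪ ⋯ ∪ q_0`
is a bijection from the admissible decomposition data onto the set of all pairings
of `(s'_{m'}, …, s'_1)`. -/
theorem decomp_bijection
    (Sarr : ℝ) (m' p' : ℕ) (hm2 : 2 ≤ m') (hme : Even m') (hp : p' < m')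
    (s' : Fin m' → ℝ) (hmono : StrictMono s')
    (hup : ∀ i : Fin m', p' ≤ (i : ℕ) → Sarr < s' i)
    (hlow : ∀ i : Fin m', (i : ℕ) < p' → s' i < Sarr) :
    Set.BijOn (decompMap p' s') (decompSet Sarr p' s')
      {Q : Finset (ℝ × ℝ) | ∃ σ ∈ pairings m', Q = realize s' σ} := by
  refine ⟨fun d hd => ?_, injOn_decompMap hp hmono hlow, ?_⟩
  · obtain ⟨σ, hσ, h⟩ := exists_realize_of_matches hmono (matches_decompMap hp hmono hd)
    exact ⟨σ, hσ, h.symm⟩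
  · rintro Q ⟨σ, hσ, rfl⟩
    exact exists_decomp hp hmono hup (matches_realize hmono hσ)

end Inchworm
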